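/- Let n ≥ 1, k ≥ 2, and let f : 𝔽₂ⁿ → {−1,1} be a k-Fourier-sparse Boolean function satisfying f̂(0ⁿ) = 1 − 2α and having Fourier dimension Fdim(f) = r. Then r ≤ 2·α·k·log₂ k. -/

import Mathlib

/-- The Fourier coefficient of `f : 𝔽₂ⁿ → ℝ` at `S ∈ 𝔽₂ⁿ`:
`f̂(S) = 2^{−n} · Σ_x f(x)·(−1)^{S·x}` where `S·x = Σᵢ Sᵢxᵢ` as an integer. -/
noncomputable def fCoeff {n : ℕ} (f : (Fin n → ZMod 2) → ℝ) (S : Fin n → ZMod 2) : ℝ :=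
  (1 / 2 ^ n) * ∑ x : Fin n → ZMod 2, f x * (-1 : ℝ) ^ (∑ i, (S i).val * (x i).val)

/-- The Fourier support of `f`. -/
noncomputable def fSupp {n : ℕ} (f : (Fin n → ZMod 2) → ℝ) : Set (Fin n → ZMod 2) :=
  {S | fCoeff f S ≠ 0}

theorem ZMod.eq_zero_or_eq_one_of_two (a : ZMod 2) : a = 0 ∨ a = 1 := by
  revert a; decide

theorem add_self_of_zmod_two {E : Type*} [AddCommGroup E] [Module (ZMod 2) E] (x : E) :
    x + x = 0 := by
  rw [← two_smul (ZMod 2) x, show (2 : ZMod 2) = 0 from rfl, zero_smul]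

theorem add_add_self_of_zmod_two {E : Type*} [AddCommGroup E] [Module (ZMod 2) E] (x y : E) :
    x + y + y = x := by
  rw [add_assoc, add_self_of_zmod_two, add_zero]

theorem mul_logb_two_add_mul_logb_two_le {a b : ℝ} (ha : 0 ≤ a) (hab : a ≤ b) :
    a * Real.logb 2 a + b * Real.logb 2 b + 2 * a ≤ (a + b) * Real.logb 2 (a + b) := by
  rcases ha.eq_or_lt with rfl | ha
  · simp
  have hb : 0 < b := ha.trans_le hab
  have h1 : Real.logb 2 a + 1 ≤ Real.logb 2 (a + b) := by
    have : Real.logb 2 (a * 2) = Real.logb 2 a + 1 := by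
      rw [Real.logb_mul ha.ne' (by norm_num), Real.logb_self_eq_one (by norm_num)]
    rw [← this]
    exact Real.logb_le_logb_of_le (by norm_num) (by positivity) (by linarith)
  have h2 : Real.logb 2 b + a / b ≤ Real.logb 2 (a + b) := by
    have h : (2 : ℝ) ^ (a / b) ≤ 1 + a / b := by
      have := rpow_one_add_le_one_add_mul_self (s := 1) (by norm_num)
        (p := a / b) (by positivity) ((div_le_one hb).2 hab)
      norm_num at this
      exact this
    have h' : a / b ≤ Real.logb 2 (1 + a / b) := by
      rwa [Real.le_logb_iff_rpow_le (by norm_num) (by positivity)]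
    have : a + b = b * (1 + a / b) := by field_simp; ring
    rw [this, Real.logb_mul hb.ne' (by positivity)]
    linarith
  have h3 : b * (a / b) = a := by field_simp
  nlinarith [mul_le_mul_of_nonneg_left h1 ha.le, mul_le_mul_of_nonneg_left h2 hb.le]

section EdgeIsoperimetry

variable {E : Type*} [AddCommGroup E] [Module (ZMod 2) E] [DecidableEq E]

/-- Edge-isoperimetric inequality: a finite set `X` induces at most `|X| log₂ |X| / 2` edges in the
Cayley graph of a linearly independent set `B`. -/
theorem sum_card_filter_add_mem_le (B : Finset E) :
    LinearIndepOn (ZMod 2) id (B : Set E) → ∀ X : Finset E,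
      ((∑ S ∈ B, {T ∈ X | T + S ∈ X}.card : ℕ) : ℝ) ≤ X.card * Real.logb 2 X.card := by
  induction B using Finset.induction with
  | empty =>
    intro _ X
    simp only [Finset.sum_empty, Nat.cast_zero]
    rcases X.card.eq_zero_or_pos with h | h
    · simp [h]
    · exact mul_nonneg (by positivity) (Real.logb_nonneg (by norm_num) (by exact_mod_cast h))
  | insert S B hS ih =>
    intro hB X
    rw [Finset.coe_insert, linearIndepOn_id_insert (by simpa using hS)] at hB
    obtain ⟨φ, hφS, hφB⟩ := Submodule.exists_le_ker_of_notMem hB.2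
    replace hφS : φ S = 1 := (ZMod.eq_zero_or_eq_one_of_two _).resolve_left hφS
    have hφB' : ∀ R ∈ B, φ R = 0 := fun R hR => hφB (Submodule.subset_span hR)
    set X₀ := {T ∈ X | φ T = 0} with hX₀
    set X₁ := {T ∈ X | ¬ φ T = 0} with hX₁
    have hcard : X₀.card + X₁.card = X.card := Finset.card_filter_add_card_filter_not _
    have hsplit : ∀ R ∈ B, {T ∈ X | T + R ∈ X}.card =
        {T ∈ X₀ | T + R ∈ X₀}.card + {T ∈ X₁ | T + R ∈ X₁}.card := by
      intro R hR
      rw [← Finset.card_filter_add_card_filter_not (s := {T ∈ X | T + R ∈ X}) (fun T => φ T = 0)]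
      congr 2 <;> ext T <;> simp [hX₀, hX₁, hφB' R hR] <;> tauto
    have h₀ : {T ∈ X₀ | T + S ∈ X}.card ≤ X₁.card := by
      refine Finset.card_le_card_of_injOn (· + S) (fun T hT => ?_) (fun _ _ _ _ h => by simpa using h)
      simp only [hX₀, Finset.coe_filter, Finset.mem_filter, Set.mem_ofPred_eq] at hT
      simp [hX₁, hT.2, hT.1.2, hφS]
    have h₁ : {T ∈ X₁ | T + S ∈ X}.card ≤ X₀.card := by
      refine Finset.card_le_card_of_injOn (· + S) (fun T hT => ?_) (fun _ _ _ _ h => by simpa using h)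
      simp only [hX₁, Finset.coe_filter, Finset.mem_filter, Set.mem_ofPred_eq] at hT
      have := (ZMod.eq_zero_or_eq_one_of_two _).resolve_left hT.1.2
      simp [hX₀, hT.2, this, hφS, show (1 : ZMod 2) + 1 = 0 from rfl]
    have hsplitS : {T ∈ X | T + S ∈ X}.card =
        {T ∈ X₀ | T + S ∈ X}.card + {T ∈ X₁ | T + S ∈ X}.card := by
      rw [← Finset.card_filter_add_card_filter_not (s := {T ∈ X | T + S ∈ X}) (fun T => φ T = 0)]
      congr 2 <;> ext T <;> simp [hX₀, hX₁] <;> tauto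
    have hS₀ : {T ∈ X₀ | T + S ∈ X}.card ≤ X₀.card := Finset.card_filter_le _ _
    have hS₁ : {T ∈ X₁ | T + S ∈ X}.card ≤ X₁.card := Finset.card_filter_le _ _
    have ih₀ := ih hB.1 X₀
    have ih₁ := ih hB.1 X₁
    rw [Finset.sum_insert hS, Finset.sum_congr rfl hsplit, Finset.sum_add_distrib, hsplitS,
      ← hcard]
    push_cast at ih₀ ih₁ ⊢
    rify at h₀ h₁ hS₀ hS₁
    rcases le_total (X₀.card : ℝ) X₁.card with h | h
    · have := mul_logb_two_add_mul_logb_two_le (by positivity) h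
      linarith
    · have := mul_logb_two_add_mul_logb_two_le (by positivity) h
      rw [add_comm (X₀.card : ℝ)]
      linarith

/-- Weighted edge-isoperimetric inequality. -/
theorem sum_sum_min_le {B : Finset E} (hB : LinearIndepOn (ZMod 2) id (B : Set E)) :
    ∀ (X : Finset E) (v : E → ℝ), (∀ T ∈ X, 0 ≤ v T) →
      ∑ S ∈ B, ∑ T ∈ X with T + S ∈ X, min (v T) (v (T + S)) ≤
        Real.logb 2 X.card * ∑ T ∈ X, v T := by
  intro X
  induction X using Finset.strongInduction with
  | H X ih =>
    intro v hv
    rcases X.eq_empty_or_nonempty with rfl | hX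
    · simp
    obtain ⟨T₀, hT₀, hmin⟩ := X.exists_min_image v hX
    set m := v T₀ with hm
    set Y := X.erase T₀ with hY
    have hYX : Y ⊂ X := Finset.erase_ssubset hT₀
    have key := ih Y hYX (fun T => v T - m)
      (fun T hT => sub_nonneg.2 (hmin T (Finset.mem_of_mem_erase hT)))
    have hedge : ∀ S ∈ B, ∑ T ∈ X with T + S ∈ X, min (v T) (v (T + S)) =
        ∑ T ∈ Y with T + S ∈ Y, min (v T - m) (v (T + S) - m) +
          m * {T ∈ X | T + S ∈ X}.card := by
      intro S _
      have h1 : ∀ T, min (v T) (v (T + S)) = min (v T - m) (v (T + S) - m) + m := fun T => by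
        rw [min_sub_sub_right]; ring
      simp_rw [h1]
      rw [Finset.sum_add_distrib, Finset.sum_const, nsmul_eq_mul, mul_comm m]
      congr 1
      symm
      refine Finset.sum_subset (fun T hT => ?_) (fun T hT hT' => ?_)
      · simp only [Finset.mem_filter] at hT ⊢
        exact ⟨hYX.1 hT.1, hYX.1 hT.2⟩
      · simp only [hY, Finset.mem_filter, Finset.mem_erase] at hT hT'
        have a := hmin _ hT.1
        have b := hmin _ hT.2
        by_cases h : T = T₀
        · subst h
          rw [min_eq_left] <;> linarith
        · have : T + S = T₀ := by tauto
          rw [this, min_eq_right] <;> linarith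
    have hsum : ∑ T ∈ X, v T = ∑ T ∈ Y, (v T - m) + m * X.card := by
      rw [← Finset.add_sum_erase _ _ hT₀, Finset.sum_sub_distrib, Finset.sum_const,
        ← Finset.card_erase_add_one hT₀]
      simp only [nsmul_eq_mul]
      push_cast
      ring
    rw [Finset.sum_congr rfl hedge, Finset.sum_add_distrib, ← Finset.mul_sum, hsum, mul_add]
    refine add_le_add (key.trans ?_) ?_
    · refine mul_le_mul_of_nonneg_right ?_
        (Finset.sum_nonneg fun T hT => sub_nonneg.2 (hmin T (Finset.mem_of_mem_erase hT)))
      rcases Y.card.eq_zero_or_pos with h | h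
      · rw [h, Nat.cast_zero, Real.logb_zero]
        exact Real.logb_nonneg (by norm_num) (by exact_mod_cast hX.card_pos)
      · exact Real.logb_le_logb_of_le (by norm_num) (by exact_mod_cast h)
          (by exact_mod_cast Finset.card_le_card hYX.1)
    · have := mul_le_mul_of_nonneg_left (sum_card_filter_add_mem_le B hB X) (hv T₀ hT₀)
      push_cast at this
      linarith

end EdgeIsoperimetry

/-- A nonempty finite family of finite sets carries a probability distribution supported on the
sets of minimal weight with respect to the marginals of that distribution. -/
theorem exists_distribution_supported_on_min_weight {E : Type*} [Fintype E] [DecidableEq E]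
    (𝓑 : Finset (Finset E)) (h𝓑 : 𝓑.Nonempty) :
    ∃ (p : Finset E → ℝ) (v : E → ℝ), (∀ B ∈ 𝓑, 0 ≤ p B) ∧ ∑ B ∈ 𝓑, p B = 1 ∧
      (∀ T, v T = ∑ B ∈ 𝓑, p B * if T ∈ B then 1 else 0) ∧
      ∀ B ∈ 𝓑, p B ≠ 0 → ∀ B' ∈ 𝓑, ∑ T ∈ B, v T ≤ ∑ T ∈ B', v T := by
  classical
  let ind : Finset E → EuclideanSpace ℝ E :=
    fun B => WithLp.toLp 2 fun T => if T ∈ B then 1 else 0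
  have hind : Function.Injective ind := by
    intro B B' h
    ext T
    have := congrArg (fun x : EuclideanSpace ℝ E => x T) h
    simp only [ind] at this
    by_cases h1 : T ∈ B <;> by_cases h2 : T ∈ B' <;> simp_all
  have hinner : ∀ (v : EuclideanSpace ℝ E) (B : Finset E),
      inner ℝ v (ind B) = ∑ T ∈ B, v T := by
    intro v B
    simp [PiLp.inner_apply, ind]
  let K : Set (EuclideanSpace ℝ E) := convexHull ℝ ((𝓑.image ind : Finset _) : Set _)
  have hK : IsComplete K := ((𝓑.image ind).finite_toSet.isCompact_convexHull ℝ).isComplete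
  have hne : K.Nonempty := by
    rw [convexHull_nonempty_iff]
    exact_mod_cast h𝓑.image ind
  obtain ⟨v, hvK, hv⟩ := exists_norm_eq_iInf_of_complete_convex hne hK (convex_convexHull ℝ _) 0
  rw [norm_eq_iInf_iff_real_inner_le_zero (convex_convexHull ℝ _) hvK] at hv
  have hopt : ∀ B ∈ 𝓑, inner ℝ v v ≤ ∑ T ∈ B, v T := by
    intro B hB
    have := hv (ind B) (subset_convexHull ℝ _ (by simpa using ⟨B, hB, rfl⟩))
    rw [zero_sub, inner_neg_left, inner_sub_right, hinner] at this
    linarith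
  obtain ⟨w, hw0, hw1, hwv⟩ := Finset.mem_convexHull'.1 hvK
  rw [Finset.sum_image hind.injOn] at hw1 hwv
  have hp0 : ∀ B ∈ 𝓑, 0 ≤ w (ind B) := fun B hB => hw0 _ (Finset.mem_image_of_mem _ hB)
  refine ⟨fun B => w (ind B), fun T => v T, hp0, hw1, ?_, ?_⟩
  · intro T
    rw [← hwv]
    simp [ind]
  · have hzero : ∑ B ∈ 𝓑, w (ind B) * (∑ T ∈ B, v T - inner ℝ v v) = 0 := by
      have h : inner ℝ v (∑ B ∈ 𝓑, w (ind B) • ind B) = inner ℝ v v := by rw [hwv]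
      rw [inner_sum] at h
      simp_rw [inner_smul_right, hinner] at h
      simp_rw [mul_sub]
      rw [Finset.sum_sub_distrib, ← Finset.sum_mul, hw1, h]
      ring
    rw [Finset.sum_eq_zero_iff_of_nonneg
      fun B hB => mul_nonneg (hp0 B hB) (sub_nonneg.2 (hopt B hB))] at hzero
    intro B hB hpB B' hB'
    have := (mul_eq_zero.1 (hzero B hB)).resolve_left hpB
    linarith [hopt B' hB']

section SmallCodimension

variable {E : Type*} [AddCommGroup E] [Module (ZMod 2) E]

theorem card_filter_mem_le_finrank [Fintype E] {B : Finset E}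
    (hB : LinearIndepOn (ZMod 2) id (B : Set E)) (W : Submodule (ZMod 2) E)
    [DecidablePred (· ∈ W)] :
    {T ∈ B | T ∈ W}.card ≤ Module.finrank (ZMod 2) W := by
  rw [← finrank_span_finset_eq_card (R := ZMod 2)
    (hB.mono (Finset.coe_subset.2 (Finset.filter_subset _ _)) :
      LinearIndepOn (ZMod 2) id (({T ∈ B | T ∈ W} : Finset E) : Set E))]
  refine Submodule.finrank_mono (Submodule.span_le.2 fun T hT => ?_)
  simp only [Finset.coe_filter, Set.mem_ofPred_eq] at hT
  exact hT.2

variable [DecidableEq E]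

theorem linearIndepOn_insert_erase {B : Finset E} (hB : LinearIndepOn (ZMod 2) id (B : Set E))
    {T Q : E} (hQ : Q ∉ Submodule.span (ZMod 2) ((B.erase T : Finset E) : Set E)) :
    LinearIndepOn (ZMod 2) id ((insert Q (B.erase T) : Finset E) : Set E) := by
  rw [Finset.coe_insert]
  exact (hB.mono (by simp)).id_insert hQ

theorem card_insert_erase_of_notMem_span {B : Finset E} {T Q : E} (hT : T ∈ B)
    (hQ : Q ∉ Submodule.span (ZMod 2) ((B.erase T : Finset E) : Set E)) :
    (insert Q (B.erase T)).card = B.card := by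
  rw [Finset.card_insert_of_notMem fun h => hQ (Submodule.subset_span h),
    Finset.card_erase_add_one hT]

/-- In a linearly independent set `B` of minimal `v`-weight, at least `|B| - dim W` elements
lie outside `W` and do not lose weight under translation by `S ∈ W`. -/
theorem card_sub_finrank_le_card_filter [Fintype E] {X B : Finset E} {v : E → ℝ} {S : E}
    {W : Submodule (ZMod 2) E} [DecidablePred (· ∈ W)] (hSX : S ∈ X) (hSW : S ∈ W)
    (hW : ∀ T ∈ X, T ∉ W → T + S ∈ X)
    (hBX : B ⊆ X) (hB : LinearIndepOn (ZMod 2) id (B : Set E))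
    (hmin : ∀ B' ⊆ X, LinearIndepOn (ZMod 2) id (B' : Set E) → B'.card = B.card →
      ∑ T ∈ B, v T ≤ ∑ T ∈ B', v T) :
    B.card ≤ {T ∈ B | T ∉ W ∧ v T ≤ v (T + S)}.card + Module.finrank (ZMod 2) W := by
  have hexch : ∀ T ∈ B, ∀ Q ∈ X,
      Q ∉ Submodule.span (ZMod 2) ((B.erase T : Finset E) : Set E) → v T ≤ v Q := by
    intro T hT Q hQ hQs
    have := hmin (insert Q (B.erase T))
      (Finset.insert_subset hQ ((Finset.erase_subset _ _).trans hBX))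
      (linearIndepOn_insert_erase hB hQs) (card_insert_erase_of_notMem_span hT hQs)
    rw [Finset.sum_insert fun h => hQs (Submodule.subset_span h),
      ← Finset.add_sum_erase _ _ hT] at this
    linarith
  have hTspan : ∀ T ∈ B, T ∉ Submodule.span (ZMod 2) ((B.erase T : Finset E) : Set E) := by
    intro T hT
    have := hB.notMem_span hT
    simpa using this
  have hcount : ∀ B' : Finset E, LinearIndepOn (ZMod 2) id (B' : Set E) →
      B'.card ≤ {T ∈ B' | T ∉ W}.card + Module.finrank (ZMod 2) W := by
    intro B' hB'
    have h1 := card_filter_mem_le_finrank hB' W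
    have h2 := Finset.card_filter_add_card_filter_not (s := B') (· ∈ W)
    omega
  have hSspan : ∀ T ∈ B, T ∉ W → v (T + S) < v T →
      S ∉ Submodule.span (ZMod 2) ((B.erase T : Finset E) : Set E) := by
    intro T hT hTW hlt hS
    refine hTspan T hT ?_
    by_contra hT'
    refine hlt.not_ge (hexch T hT _ (hW T (hBX hT) hTW) fun h => hT' ?_)
    have := Submodule.sub_mem _ h hS
    simpa using this
  have huniq : ∀ T ∈ B, ∀ Q ∈ B, T ∉ W → Q ∉ W → v (T + S) < v T → v (Q + S) < v Q →
      T ≠ Q → v T < v Q := by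
    intro T hT Q hQ hTW hQW hTlt hQlt hne
    refine (hexch T hT _ (hW Q (hBX hQ) hQW) fun h => hSspan T hT hTW hTlt ?_).trans_lt hQlt
    have hQ' : Q ∈ Submodule.span (ZMod 2) ((B.erase T : Finset E) : Set E) :=
      Submodule.subset_span (Finset.mem_erase.2 ⟨hne.symm, hQ⟩)
    have := Submodule.sub_mem _ h hQ'
    simpa using this
  by_cases hbad : ∃ T ∈ B, T ∉ W ∧ v (T + S) < v T
  · obtain ⟨T, hT, hTW, hlt⟩ := hbad
    have hS := hSspan T hT hTW hlt
    have h1 := hcount _ (linearIndepOn_insert_erase hB hS)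
    rw [card_insert_erase_of_notMem_span hT hS] at h1
    refine h1.trans (Nat.add_le_add_right (Finset.card_le_card fun Q hQ => ?_) _)
    simp only [Finset.mem_filter, Finset.mem_insert, Finset.mem_erase] at hQ ⊢
    obtain ⟨rfl | ⟨hQT, hQB⟩, hQW⟩ := hQ
    · exact absurd hSW hQW
    · refine ⟨hQB, hQW, not_lt.1 fun hQlt => ?_⟩
      exact (huniq T hT Q hQB hTW hQW hlt hQlt hQT.symm).not_gt
        (huniq Q hQB T hT hQW hTW hQlt hlt hQT)
  · push Not at hbad
    refine (hcount B hB).trans (Nat.add_le_add_right (Finset.card_le_card fun Q hQ => ?_) _)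
    simp only [Finset.mem_filter] at hQ ⊢
    exact ⟨hQ.1, hQ.2, hbad Q hQ.1 hQ.2⟩

/-- If every nonzero `S ∈ X` lies in a subspace `W S` such that `X \ W S` is mapped into `X` by
translation by `S`, then some `W S` has codimension at most `log₂ |X|` in the span of `X`. -/
theorem exists_finrank_span_le_finrank_add_logb [Fintype E] (X : Finset E)
    (W : E → Submodule (ZMod 2) E)
    (hSW : ∀ S ∈ X, S ≠ 0 → S ∈ W S)
    (hW : ∀ S ∈ X, S ≠ 0 → ∀ T ∈ X, T ∉ W S → T + S ∈ X)
    (hr : 0 < Module.finrank (ZMod 2) (Submodule.span (ZMod 2) (X : Set E))) :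
    ∃ S ∈ X, S ≠ 0 ∧ (Module.finrank (ZMod 2) (Submodule.span (ZMod 2) (X : Set E)) : ℝ) ≤
      Module.finrank (ZMod 2) (W S) + Real.logb 2 X.card := by
  classical
  set r := Module.finrank (ZMod 2) (Submodule.span (ZMod 2) (X : Set E)) with hr_def
  let 𝓑 : Finset (Finset E) :=
    {B ∈ X.powerset | LinearIndepOn (ZMod 2) id (B : Set E) ∧ B.card = r}
  have h𝓑 : 𝓑.Nonempty := by
    obtain ⟨b, hbX, hspan, hb⟩ := exists_linearIndependent (ZMod 2) (X : Set E)
    have hb' : LinearIndepOn (ZMod 2) id (b.toFinset : Set E) := by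
      rw [Set.coe_toFinset]
      exact hb
    refine ⟨b.toFinset, ?_⟩
    simp only [𝓑, Finset.mem_filter, Finset.mem_powerset]
    refine ⟨by simpa [Finset.subset_iff, Set.subset_def] using hbX, hb', ?_⟩
    rw [← finrank_span_finset_eq_card hb', Set.coe_toFinset, hspan]
  have hmem : ∀ B, B ∈ 𝓑 ↔ B ⊆ X ∧ LinearIndepOn (ZMod 2) id (B : Set E) ∧ B.card = r := by
    simp [𝓑]
  obtain ⟨p, v, hp0, hp1, hv, hmin⟩ := exists_distribution_supported_on_min_weight 𝓑 h𝓑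
  have hv0 : ∀ T, 0 ≤ v T := fun T => by
    rw [hv]
    exact Finset.sum_nonneg fun B hB => mul_nonneg (hp0 B hB) (by split_ifs <;> norm_num)
  have hvC : ∀ C : Finset E, ∑ T ∈ C, v T = ∑ B ∈ 𝓑, p B * (C ∩ B).card := by
    intro C
    simp_rw [hv]
    rw [Finset.sum_comm]
    refine Finset.sum_congr rfl fun B _ => ?_
    rw [← Finset.mul_sum, Finset.sum_ite_mem]
    simp
  have hvX : ∑ T ∈ X, v T = r := by
    rw [hvC, ← one_mul (r : ℝ), ← hp1, Finset.sum_mul]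
    refine Finset.sum_congr rfl fun B hB => ?_
    rw [Finset.inter_eq_right.2 ((hmem B).1 hB).1, ((hmem B).1 hB).2.2]
  obtain ⟨B, hB⟩ := h𝓑
  obtain ⟨hBX, hBind, hBcard⟩ := (hmem B).1 hB
  have hB0 : ∀ S ∈ B, S ≠ 0 := fun S hS => hBind.ne_zero hS
  have hcodim : ∀ S ∈ B, (r : ℝ) - Module.finrank (ZMod 2) (W S) ≤
      ∑ T ∈ X with T + S ∈ X, min (v T) (v (T + S)) := by
    intro S hS
    have hSX := hBX hS
    set C := {T ∈ X | T ∉ W S ∧ v T ≤ v (T + S)} with hC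
    calc (r : ℝ) - Module.finrank (ZMod 2) (W S)
        = ∑ B' ∈ 𝓑, p B' * ((r : ℝ) - Module.finrank (ZMod 2) (W S)) := by
          rw [← Finset.sum_mul, hp1, one_mul]
      _ ≤ ∑ B' ∈ 𝓑, p B' * (C ∩ B').card := by
          refine Finset.sum_le_sum fun B' hB' => ?_
          by_cases hpB : p B' = 0
          · simp [hpB]
          refine mul_le_mul_of_nonneg_left ?_ (hp0 B' hB')
          obtain ⟨h1, h2, h3⟩ := (hmem B').1 hB'
          have := card_sub_finrank_le_card_filter (v := v) hSX (hSW S hSX (hB0 S hS))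
            (hW S hSX (hB0 S hS)) h1 h2
            (fun B'' k1 k2 k3 => hmin B' hB' hpB B'' ((hmem B'').2 ⟨k1, k2, k3.trans h3⟩))
          have hCB : C ∩ B' = {T ∈ B' | T ∉ W S ∧ v T ≤ v (T + S)} := by
            ext T
            simp only [hC, Finset.mem_inter, Finset.mem_filter]
            exact ⟨fun h => ⟨h.2, h.1.2⟩, fun h => ⟨⟨h1 h.1, h.2⟩, h.1⟩⟩
          rw [hCB, sub_le_iff_le_add, ← h3]
          exact_mod_cast this
      _ = ∑ T ∈ C, v T := (hvC C).symm
      _ = ∑ T ∈ C, min (v T) (v (T + S)) := by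
          refine Finset.sum_congr rfl fun T hT => ?_
          rw [min_eq_left (Finset.mem_filter.1 hT).2.2]
      _ ≤ ∑ T ∈ X with T + S ∈ X, min (v T) (v (T + S)) := by
          refine Finset.sum_le_sum_of_subset_of_nonneg (fun T hT => ?_)
            fun T _ _ => le_min (hv0 _) (hv0 _)
          simp only [hC, Finset.mem_filter] at hT ⊢
          exact ⟨hT.1, hW S hSX (hB0 S hS) T hT.1 hT.2.1⟩
  have htotal := (Finset.sum_le_sum hcodim).trans (sum_sum_min_le hBind X v fun T _ => hv0 T)
  rw [hvX] at htotal
  obtain ⟨S, hS, hle⟩ := Finset.exists_le_of_sum_le (s := B)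
    (f := fun S => (r : ℝ) - Module.finrank (ZMod 2) (W S)) (g := fun _ => Real.logb 2 X.card)
    (Finset.card_pos.1 (hBcard ▸ hr))
    (htotal.trans_eq (by rw [Finset.sum_const, hBcard, nsmul_eq_mul, mul_comm]))
  exact ⟨S, hBX hS, hB0 S hS, by linarith⟩

end SmallCodimension

section Walsh

variable {n : ℕ}

/-- The character `x ↦ (-1)^{S·x}` of `𝔽₂ⁿ`. -/
noncomputable def walsh (S x : Fin n → ZMod 2) : ℝ := (-1) ^ (S ⬝ᵥ x).val

theorem neg_one_pow_val_add (a b : ZMod 2) :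
    (-1 : ℝ) ^ (a + b).val = (-1) ^ a.val * (-1) ^ b.val := by
  rw [← pow_add, neg_one_pow_eq_pow_mod_two (a.val + b.val), ← ZMod.val_add]

theorem walsh_add_left (S T x : Fin n → ZMod 2) : walsh (S + T) x = walsh S x * walsh T x := by
  rw [walsh, add_dotProduct, neg_one_pow_val_add, walsh, walsh]

theorem walsh_add_right (S x y : Fin n → ZMod 2) : walsh S (x + y) = walsh S x * walsh S y := by
  rw [walsh, dotProduct_add, neg_one_pow_val_add, walsh, walsh]

theorem walsh_comm (S x : Fin n → ZMod 2) : walsh S x = walsh x S := by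
  rw [walsh, walsh, dotProduct_comm]

theorem walsh_zero_left (x : Fin n → ZMod 2) : walsh 0 x = 1 := by
  simp [walsh]

theorem walsh_of_dotProduct_eq_zero {S x : Fin n → ZMod 2} (h : S ⬝ᵥ x = 0) : walsh S x = 1 := by
  simp [walsh, h]

theorem walsh_of_dotProduct_eq_one {S x : Fin n → ZMod 2} (h : S ⬝ᵥ x = 1) : walsh S x = -1 := by
  simp [walsh, h, ZMod.val_one]

theorem walsh_eq_one_or (S x : Fin n → ZMod 2) : walsh S x = 1 ∨ walsh S x = -1 :=
  neg_one_pow_eq_or ℝ _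

theorem exists_dotProduct_eq_one {S : Fin n → ZMod 2} (hS : S ≠ 0) :
    ∃ u, S ⬝ᵥ u = 1 := by
  obtain ⟨i, hi⟩ := Function.ne_iff.1 hS
  refine ⟨Pi.single i 1, ?_⟩
  rw [dotProduct_single_one]
  exact (ZMod.eq_zero_or_eq_one_of_two _).resolve_left hi

theorem sum_submodule_walsh_eq_zero {S : Fin n → ZMod 2} (G : Submodule (ZMod 2) (Fin n → ZMod 2))
    [Fintype G] {g : Fin n → ZMod 2} (hg : g ∈ G) (hSg : S ⬝ᵥ g = 1) :
    ∑ x : G, walsh S x = 0 := by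
  have h := Equiv.sum_comp (Equiv.addRight (⟨g, hg⟩ : G)) fun x : G => walsh S x
  simp only [Equiv.coe_addRight, Submodule.coe_add, walsh_add_right,
    walsh_of_dotProduct_eq_one hSg, ← Finset.sum_mul] at h
  linarith

theorem sum_walsh_eq_zero {S : Fin n → ZMod 2} (hS : S ≠ 0) :
    ∑ x, walsh S x = 0 := by
  obtain ⟨u, hu⟩ := exists_dotProduct_eq_one hS
  have h := Equiv.sum_comp (Equiv.addRight u) fun x => walsh S x
  simp only [Equiv.coe_addRight, walsh_add_right, walsh_of_dotProduct_eq_one hu,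
    ← Finset.sum_mul] at h
  linarith

theorem fCoeff_eq (f : (Fin n → ZMod 2) → ℝ) (S : Fin n → ZMod 2) :
    fCoeff f S = (1 / 2 ^ n) * ∑ x, f x * walsh S x := by
  unfold fCoeff walsh
  congr 1
  refine Finset.sum_congr rfl fun x _ => ?_
  have : (S ⬝ᵥ x).val = (∑ i, (S i).val * (x i).val) % 2 := by
    rw [← ZMod.val_natCast]
    simp [dotProduct]
  rw [this, ← neg_one_pow_eq_pow_mod_two]

theorem sum_fCoeff_mul_walsh (f : (Fin n → ZMod 2) → ℝ) (x : Fin n → ZMod 2) :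
    ∑ S, fCoeff f S * walsh S x = f x := by
  have h : ∀ y, ∑ S, walsh S y * walsh S x = if y = x then 2 ^ n else 0 := by
    intro y
    simp_rw [← walsh_add_right, walsh_comm _ (y + x)]
    split_ifs with hyx
    · simp [hyx, add_self_of_zmod_two, walsh_zero_left, ZMod.card]
    · refine sum_walsh_eq_zero fun h0 => hyx ?_
      rw [← add_add_self_of_zmod_two y x, h0, zero_add]
  simp_rw [fCoeff_eq, mul_assoc, ← Finset.mul_sum, Finset.sum_mul]
  rw [Finset.sum_comm]
  simp_rw [mul_assoc, ← Finset.mul_sum, h]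
  simp only [mul_ite, mul_zero, Finset.sum_ite_eq', Finset.mem_univ, if_true]
  field_simp

/-- Restriction of a function to the hyperplane `S·x = β`, extended to be constant along `u`. -/
def hyperplaneRestrict (S u : Fin n → ZMod 2) (β : ZMod 2) (f : (Fin n → ZMod 2) → ℝ)
    (x : Fin n → ZMod 2) : ℝ :=
  f (x + (S ⬝ᵥ x + β) • u)

theorem sum_hyperplaneRestrict {S u : Fin n → ZMod 2} (hu : S ⬝ᵥ u = 1) (β : ZMod 2)
    (g : (Fin n → ZMod 2) → ℝ) :
    ∑ x, hyperplaneRestrict S u β g x = ∑ x, g x * (1 + (-1) ^ β.val * walsh S x) := by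
  have hcases : ∀ a b : ZMod 2, a + b = 0 ∧ a + 1 + b = 1 ∨ a + b = 1 ∧ a + 1 + b = 0 := by decide
  have h1 : ∀ x, hyperplaneRestrict S u β g x =
      (if S ⬝ᵥ x + β = 0 then g x else 0) +
        (if S ⬝ᵥ (x + u) + β = 0 then g (x + u) else 0) := by
    intro x
    rw [dotProduct_add, hu, hyperplaneRestrict]
    rcases hcases (S ⬝ᵥ x) β with ⟨h, h'⟩ | ⟨h, h'⟩ <;> simp [h, h']
  have h2 : ∑ x, (if S ⬝ᵥ (x + u) + β = 0 then g (x + u) else 0) =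
      ∑ x, if S ⬝ᵥ x + β = 0 then g x else 0 :=
    Equiv.sum_comp (Equiv.addRight u) fun x => if S ⬝ᵥ x + β = 0 then g x else 0
  simp_rw [h1]
  rw [Finset.sum_add_distrib, h2, ← Finset.sum_add_distrib]
  refine Finset.sum_congr rfl fun x _ => ?_
  rw [walsh, ← neg_one_pow_val_add, add_comm β]
  rcases ZMod.eq_zero_or_eq_one_of_two (S ⬝ᵥ x + β) with h | h
  · simp [h]; ring
  · simp [h, ZMod.val_one]

theorem fCoeff_hyperplaneRestrict_of_eq_zero {S u T : Fin n → ZMod 2} (hu : S ⬝ᵥ u = 1)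
    (β : ZMod 2) (f : (Fin n → ZMod 2) → ℝ) (hT : T ⬝ᵥ u = 0) :
    fCoeff (hyperplaneRestrict S u β f) T = fCoeff f T + (-1) ^ β.val * fCoeff f (T + S) := by
  have h : ∀ x, hyperplaneRestrict S u β f x * walsh T x =
      hyperplaneRestrict S u β (fun x => f x * walsh T x) x := by
    intro x
    have : walsh T (x + (S ⬝ᵥ x + β) • u) = walsh T x := by
      rw [walsh_add_right, walsh_of_dotProduct_eq_zero (x := _ • u), mul_one]
      rw [dotProduct_smul, hT, smul_zero]
    simp only [hyperplaneRestrict, this]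
  simp_rw [fCoeff_eq, h, sum_hyperplaneRestrict hu, walsh_add_left]
  rw [mul_left_comm, ← mul_add]
  congr 1
  rw [Finset.mul_sum, ← Finset.sum_add_distrib]
  exact Finset.sum_congr rfl fun x _ => by ring

theorem fCoeff_hyperplaneRestrict_of_eq_one {S u T : Fin n → ZMod 2} (hu : S ⬝ᵥ u = 1)
    (β : ZMod 2) (f : (Fin n → ZMod 2) → ℝ) (hT : T ⬝ᵥ u = 1) :
    fCoeff (hyperplaneRestrict S u β f) T = 0 := by
  have h := Equiv.sum_comp (Equiv.addRight u) fun x => hyperplaneRestrict S u β f x * walsh T x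
  have hinv : ∀ x, hyperplaneRestrict S u β f (x + u) = hyperplaneRestrict S u β f x := by
    intro x
    unfold hyperplaneRestrict
    congr 1
    rw [dotProduct_add, hu, add_right_comm (S ⬝ᵥ x), add_smul _ (1 : ZMod 2), one_smul,
      add_add_add_comm, add_comm u, ← add_assoc, add_add_self_of_zmod_two]
  simp only [Equiv.coe_addRight, hinv, walsh_add_right, walsh_of_dotProduct_eq_one hT, mul_neg,
    mul_one, Finset.sum_neg_distrib] at h
  rw [fCoeff_eq, show ∑ x, hyperplaneRestrict S u β f x * walsh T x = 0 by linarith, mul_zero]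

theorem fCoeff_add_of_mem_fSupp_hyperplaneRestrict {S u T : Fin n → ZMod 2} (hu : S ⬝ᵥ u = 1)
    (β : ZMod 2) (f : (Fin n → ZMod 2) → ℝ) (hT : T ∈ fSupp (hyperplaneRestrict S u β f)) :
    T ⬝ᵥ u = 0 ∧ (T ∉ fSupp f → T + S ∈ fSupp f) := by
  have hTu : T ⬝ᵥ u = 0 := by
    refine (ZMod.eq_zero_or_eq_one_of_two _).resolve_right fun h => hT ?_
    exact fCoeff_hyperplaneRestrict_of_eq_one hu β f h
  refine ⟨hTu, fun h hS => hT ?_⟩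
  have h' : fCoeff f T = 0 := not_not.1 h
  rw [fCoeff_hyperplaneRestrict_of_eq_zero hu β f hTu, h', hS, mul_zero, add_zero]

theorem ncard_fSupp_hyperplaneRestrict_le {S u : Fin n → ZMod 2} (hu : S ⬝ᵥ u = 1)
    (β : ZMod 2) (f : (Fin n → ZMod 2) → ℝ) :
    (fSupp (hyperplaneRestrict S u β f)).ncard ≤ (fSupp f).ncard := by
  classical
  refine Set.ncard_le_ncard_of_injOn (fun T => if T ∈ fSupp f then T else T + S) ?_ ?_
  · intro T hT
    have := (fCoeff_add_of_mem_fSupp_hyperplaneRestrict hu β f hT).2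
    split_ifs with h
    exacts [h, this h]
  · intro T hT Q hQ hTQ
    have h1 := (fCoeff_add_of_mem_fSupp_hyperplaneRestrict hu β f hT).1
    have h2 := (fCoeff_add_of_mem_fSupp_hyperplaneRestrict hu β f hQ).1
    have h3 := congrArg (· ⬝ᵥ u) hTQ
    simp only at hTQ h3
    split_ifs at hTQ h3
    · exact hTQ
    · simp [add_dotProduct, h1, h2, hu] at h3
    · simp [add_dotProduct, h1, h2, hu] at h3
    · exact add_right_cancel hTQ

theorem add_mem_fSupp_of_notMem {S u T : Fin n → ZMod 2} (hu : S ⬝ᵥ u = 1)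
    (β : ZMod 2) (f : (Fin n → ZMod 2) → ℝ) (hT : T ∈ fSupp f)
    (hTW : T ∉ Submodule.span (ZMod 2) {S} ⊔
      Submodule.span (ZMod 2) (fSupp (hyperplaneRestrict S u β f))) :
    T + S ∈ fSupp f := by
  intro hTS
  apply hTW
  rcases ZMod.eq_zero_or_eq_one_of_two (T ⬝ᵥ u) with h | h
  · refine Submodule.mem_sup_right (Submodule.subset_span ?_)
    simpa [fSupp, fCoeff_hyperplaneRestrict_of_eq_zero hu β f h, hTS] using hT
  · have h' : (T + S) ⬝ᵥ u = 0 := by rw [add_dotProduct, h, hu]; rfl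
    have hmem : T + S ∈ fSupp (hyperplaneRestrict S u β f) := by
      simpa [fSupp, fCoeff_hyperplaneRestrict_of_eq_zero hu β f h', hTS,
        add_add_self_of_zmod_two] using hT
    rw [← add_add_self_of_zmod_two T S]
    exact Submodule.add_mem _ (Submodule.mem_sup_right (Submodule.subset_span hmem))
      (Submodule.mem_sup_left (Submodule.mem_span_singleton_self S))

/-- A subspace of size at most `|X|` on which `S` differs from every other element of `X`. -/
theorem exists_submodule_separating (X : Finset (Fin n → ZMod 2)) {S : Fin n → ZMod 2}
    (hS : S ∈ X) :
    ∃ G : Submodule (ZMod 2) (Fin n → ZMod 2), Nat.card G ≤ X.card ∧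
      ∀ T ∈ X, T ≠ S → ∃ g ∈ G, (T + S) ⬝ᵥ g = 1 := by
  classical
  let P : Set (Submodule (ZMod 2) (Fin n → ZMod 2)) :=
    {G | ∀ T ∈ X, T ≠ S → ∃ g ∈ G, (T + S) ⬝ᵥ g = 1}
  have hne : P.Nonempty := by
    refine ⟨⊤, fun T _ hTS => ?_⟩
    have h0 : T + S ≠ 0 := fun h => hTS (by
      rw [← add_add_self_of_zmod_two T S, h, zero_add])
    obtain ⟨u, hu⟩ := exists_dotProduct_eq_one h0
    exact ⟨u, trivial, hu⟩
  obtain ⟨G, hG⟩ := P.toFinite.exists_minimal hne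
  refine ⟨G, ?_, hG.prop⟩
  let F : (Fin n → ZMod 2) → Module.Dual (ZMod 2) G := fun T =>
    (dotProductBilin (ZMod 2) (ZMod 2) (T + S)).comp G.subtype
  have hF : ∀ T (g : G), F T g = (T + S) ⬝ᵥ (g : Fin n → ZMod 2) := fun T g => rfl
  have hsurj : ∀ ψ : Module.Dual (ZMod 2) G, ∃ T ∈ X, F T = ψ := by
    intro ψ
    by_contra! hψ
    have hψ0 : ψ ≠ 0 := by
      rintro rfl
      refine hψ S hS (LinearMap.ext fun g => ?_)
      rw [hF, add_self_of_zmod_two, zero_dotProduct]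
      rfl
    obtain ⟨g, hg⟩ : ∃ g, ψ g ≠ 0 := by
      by_contra! h
      exact hψ0 (LinearMap.ext h)
    have hker : (LinearMap.ker ψ).map G.subtype ∈ P := by
      intro T hT hTS
      by_contra! h
      have hzero : ∀ x : G, ψ x = 0 → F T x = 0 := fun x hx =>
        (ZMod.eq_zero_or_eq_one_of_two _).resolve_right
          (h x (Submodule.mem_map_of_mem (f := G.subtype) (LinearMap.mem_ker.2 hx)))
      replace hg := (ZMod.eq_zero_or_eq_one_of_two (ψ g)).resolve_left hg
      have hone : ∀ x : G, ψ x = 1 → F T x = F T g := fun x hx => by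
        have := hzero (x - g) (by rw [map_sub, hx, hg, sub_self])
        rwa [map_sub, sub_eq_zero] at this
      rcases ZMod.eq_zero_or_eq_one_of_two (F T g) with hgT | hgT
      · obtain ⟨y, hy, hy1⟩ := hG.prop T hT hTS
        have : F T ⟨y, hy⟩ = 1 := hy1
        rcases ZMod.eq_zero_or_eq_one_of_two (ψ ⟨y, hy⟩) with h0 | h1
        · simp [hzero _ h0] at this
        · simp [hone _ h1, hgT] at this
      · refine hψ T hT (LinearMap.ext fun x => ?_)
        rcases ZMod.eq_zero_or_eq_one_of_two (ψ x) with h0 | h1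
        · rw [h0, hzero _ h0]
        · rw [h1, hone _ h1, hgT]
    have hle := hG.le_of_le hker (Submodule.map_subtype_le _ _)
    obtain ⟨x, hx, hxg⟩ := hle g.2
    have : x = g := Subtype.ext hxg
    exact hg (this ▸ hx)
  have : Finite (Module.Dual (ZMod 2) G) := Module.finite_of_finite (ZMod 2)
  have := Fintype.ofFinite (Module.Dual (ZMod 2) G)
  have := Fintype.ofFinite G
  have hcard : Nat.card G = Fintype.card (Module.Dual (ZMod 2) G) := by
    rw [Nat.card_eq_fintype_card, Module.card_eq_pow_finrank (K := ZMod 2) (V := G),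
      Module.card_eq_pow_finrank (K := ZMod 2) (V := Module.Dual (ZMod 2) G),
      Subspace.dual_finrank_eq]
  rw [hcard, ← Finset.card_univ]
  refine (Finset.card_le_card fun ψ _ => ?_).trans (Finset.card_image_le (f := F) (s := X))
  obtain ⟨T, hT, rfl⟩ := hsurj ψ
  exact Finset.mem_image_of_mem F hT

theorem two_le_abs_sum_of_even_card {ι : Type*} [Fintype ι] (h : ι → ℝ)
    (hh : ∀ x, h x = 1 ∨ h x = -1) (heven : Even (Fintype.card ι)) (hne : ∑ x, h x ≠ 0) :
    2 ≤ |∑ x, h x| := by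
  classical
  have hsum : ∑ x, h x = ((Fintype.card ι : ℤ) - 2 * ({x | h x = -1} : Finset ι).card : ℤ) := by
    have : ∀ x, h x = 1 - 2 * if h x = -1 then 1 else 0 := fun x => by
      rcases hh x with h1 | h1 <;> norm_num [h1]
    rw [Finset.sum_congr rfl fun x _ => this x, Finset.sum_sub_distrib, ← Finset.mul_sum,
      Finset.sum_boole]
    simp
  rw [hsum] at hne ⊢
  obtain ⟨m, hm⟩ := heven
  rw [hm] at hne ⊢
  have hz : ((m + m : ℕ) : ℤ) - 2 * ({x | h x = -1} : Finset ι).card ≠ 0 := by exact_mod_cast hne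
  have : (2 : ℤ) ≤ |((m + m : ℕ) : ℤ) - 2 * ({x | h x = -1} : Finset ι).card| := by
    rw [le_abs]
    omega
  exact_mod_cast this

/-- Granularity: nonzero Fourier coefficients of a `k`-Fourier-sparse Boolean function have
absolute value at least `2 / k`. -/
theorem two_div_le_abs_fCoeff {k : ℕ} (hk : 2 ≤ k) {f : (Fin n → ZMod 2) → ℝ}
    (hf : ∀ x, f x = 1 ∨ f x = -1) (hsparse : (fSupp f).ncard ≤ k) {S : Fin n → ZMod 2}
    (hS : S ∈ fSupp f) : 2 / (k : ℝ) ≤ |fCoeff f S| := by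
  classical
  obtain ⟨G, hGcard, hG⟩ := exists_submodule_separating (fSupp f).toFinset (S := S) (by simpa)
  rw [← Set.ncard_eq_toFinset_card'] at hGcard
  have := Fintype.ofFinite G
  rw [Nat.card_eq_fintype_card] at hGcard
  have hsum : ∑ x : G, f x * walsh S x = Fintype.card G * fCoeff f S := by
    calc ∑ x : G, f x * walsh S x
        = ∑ x : G, ∑ T, fCoeff f T * walsh (T + S) x := by
          refine Finset.sum_congr rfl fun x _ => ?_
          simp_rw [walsh_add_left, ← mul_assoc, ← Finset.sum_mul, sum_fCoeff_mul_walsh]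
      _ = ∑ T, fCoeff f T * ∑ x : G, walsh (T + S) x := by
          rw [Finset.sum_comm]
          simp_rw [Finset.mul_sum]
      _ = fCoeff f S * ∑ x : G, walsh (S + S) x := by
          refine Finset.sum_eq_single S (fun T _ hTS => ?_) (by simp)
          by_cases hT : T ∈ fSupp f
          · obtain ⟨g, hg, hg1⟩ := hG T (by simpa) hTS
            rw [sum_submodule_walsh_eq_zero G hg hg1, mul_zero]
          · rw [show fCoeff f T = 0 from not_not.1 hT, zero_mul]
      _ = Fintype.card G * fCoeff f S := by
          simp [add_self_of_zmod_two, walsh_zero_left, mul_comm]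
  have hGpos : (0 : ℝ) < Fintype.card G := by exact_mod_cast Fintype.card_pos
  have hGk : (Fintype.card G : ℝ) ≤ k := by exact_mod_cast hGcard.trans hsparse
  have hval : ∀ x : G, f x * walsh S x = 1 ∨ f x * walsh S x = -1 := fun x => by
    rcases hf x with h | h <;> rcases walsh_eq_one_or S (x : Fin n → ZMod 2) with h' | h' <;>
      simp [h, h']
  have hne : ∑ x : G, f x * walsh S x ≠ 0 := by
    rw [hsum]
    exact mul_ne_zero hGpos.ne' hS
  have habs : |∑ x : G, f x * walsh S x| = Fintype.card G * |fCoeff f S| := by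
    rw [hsum, abs_mul, abs_of_pos hGpos]
  have hk' : (2 : ℝ) ≤ k := by exact_mod_cast hk
  rw [div_le_iff₀ (by linarith)]
  have hcard := Module.card_eq_pow_finrank (K := ZMod 2) (V := G)
  rw [ZMod.card] at hcard
  rcases Nat.eq_zero_or_pos (Module.finrank (ZMod 2) G) with h0 | h0
  · rw [h0, pow_zero] at hcard
    obtain ⟨x₀, hx₀⟩ := Fintype.card_eq_one_iff.1 hcard
    have h1 : |∑ x : G, f x * walsh S x| = 1 := by
      rw [Fintype.sum_eq_single x₀ fun x hx => absurd (hx₀ x) hx]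
      rcases hval x₀ with h | h <;> simp [h]
    rw [habs, hcard, Nat.cast_one, one_mul] at h1
    rwa [h1, one_mul]
  · have h2 := two_le_abs_sum_of_even_card _ hval
      (hcard ▸ (even_two.pow_of_ne_zero h0.ne')) hne
    rw [habs] at h2
    nlinarith [abs_nonneg (fCoeff f S)]

theorem fCoeff_zero_le_one {f : (Fin n → ZMod 2) → ℝ} (hf : ∀ x, f x = 1 ∨ f x = -1) :
    fCoeff f 0 ≤ 1 := by
  rw [fCoeff_eq]
  have : ∑ x, f x * walsh 0 x ≤ ∑ _x : Fin n → ZMod 2, (1 : ℝ) := by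
    refine Finset.sum_le_sum fun x _ => ?_
    rw [walsh_zero_left]
    rcases hf x with h | h <;> norm_num [h]
  rw [Finset.sum_const, Finset.card_univ, Fintype.card_fun, ZMod.card, Fintype.card_fin,
    nsmul_eq_mul, mul_one] at this
  push_cast at this
  rw [one_div, inv_mul_le_iff₀ (by positivity), mul_one]
  exact this

/-- Some restriction of a nonconstant `k`-Fourier-sparse Boolean function to a hyperplane increases
the mean by at least `2 / k` and lowers the Fourier dimension by at most `2 log₂ k`. -/
theorem exists_hyperplaneRestrict {k : ℕ} (hk : 2 ≤ k) {f : (Fin n → ZMod 2) → ℝ}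
    (hf : ∀ x, f x = 1 ∨ f x = -1) (hsparse : (fSupp f).ncard ≤ k)
    (hr : 0 < Module.finrank (ZMod 2) (Submodule.span (ZMod 2) (fSupp f))) :
    ∃ g : (Fin n → ZMod 2) → ℝ, (∀ x, g x = 1 ∨ g x = -1) ∧ (fSupp g).ncard ≤ k ∧
      fCoeff f 0 + 2 / k ≤ fCoeff g 0 ∧
      (Module.finrank (ZMod 2) (Submodule.span (ZMod 2) (fSupp f)) : ℝ) ≤
        Module.finrank (ZMod 2) (Submodule.span (ZMod 2) (fSupp g)) + 2 * Real.logb 2 k := by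
  classical
  choose! u hu using fun (S : Fin n → ZMod 2) (hS : S ≠ 0) => exists_dotProduct_eq_one hS
  have hsign : ∀ S, ∃ β : ZMod 2, (-1) ^ β.val * fCoeff f S = |fCoeff f S| := by
    intro S
    rcases le_total 0 (fCoeff f S) with h | h
    · exact ⟨0, by simp [abs_of_nonneg h]⟩
    · exact ⟨1, by simp [abs_of_nonpos h, ZMod.val_one]⟩
  choose β hβ using hsign
  have hX : ((fSupp f).toFinset : Set (Fin n → ZMod 2)) = fSupp f := Set.coe_toFinset _
  obtain ⟨S, hS, hS0, hle⟩ := exists_finrank_span_le_finrank_add_logb (fSupp f).toFinset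
    (fun S => Submodule.span (ZMod 2) {S} ⊔
      Submodule.span (ZMod 2) (fSupp (hyperplaneRestrict S (u S) (β S) f)))
    (fun S _ _ => Submodule.mem_sup_left (Submodule.mem_span_singleton_self S))
    (fun S _ hS0 T hT hTW => by
      rw [Set.mem_toFinset] at hT ⊢
      exact add_mem_fSupp_of_notMem (hu S hS0) _ f hT hTW)
    (by rwa [hX])
  rw [hX] at hle
  rw [Set.mem_toFinset] at hS
  refine ⟨hyperplaneRestrict S (u S) (β S) f, fun x => hf _,
    (ncard_fSupp_hyperplaneRestrict_le (hu S hS0) _ f).trans hsparse, ?_, ?_⟩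
  · rw [fCoeff_hyperplaneRestrict_of_eq_zero (hu S hS0) _ f (zero_dotProduct _), zero_add, hβ]
    exact add_le_add_right (two_div_le_abs_fCoeff hk hf hsparse hS) _
  · have hfin := Submodule.finrank_add_le_finrank_add_finrank (Submodule.span (ZMod 2) {S})
      (Submodule.span (ZMod 2) (fSupp (hyperplaneRestrict S (u S) (β S) f)))
    rw [finrank_span_singleton hS0] at hfin
    rify at hfin
    have hlog : Real.logb 2 (fSupp f).toFinset.card ≤ Real.logb 2 k := by
      refine Real.logb_le_logb_of_le (by norm_num) ?_ ?_
      · exact_mod_cast Finset.card_pos.2 ⟨S, by simpa⟩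
      · rw [← Set.ncard_eq_toFinset_card']
        exact_mod_cast hsparse
    have hone : 1 ≤ Real.logb 2 k := by
      rw [Real.le_logb_iff_rpow_le (by norm_num) (by positivity), Real.rpow_one]
      exact_mod_cast hk
    linarith

theorem finrank_span_fSupp_le {k : ℕ} (hk : 2 ≤ k) (N : ℕ) :
    ∀ f : (Fin n → ZMod 2) → ℝ, (∀ x, f x = 1 ∨ f x = -1) → (fSupp f).ncard ≤ k →
      (1 - fCoeff f 0) * k < 2 * N →
      (Module.finrank (ZMod 2) (Submodule.span (ZMod 2) (fSupp f)) : ℝ) ≤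
        (1 - fCoeff f 0) * k * Real.logb 2 k := by
  have hk' : (0 : ℝ) < k := by positivity
  have hlog : 0 ≤ Real.logb 2 k := Real.logb_nonneg (by norm_num) (by exact_mod_cast (by omega))
  induction N with
  | zero =>
    intro f hf _ hN
    have := mul_nonneg (sub_nonneg.2 (fCoeff_zero_le_one hf)) hk'.le
    norm_num at hN
    linarith
  | succ N ih =>
    intro f hf hsparse hN
    have h0 := mul_nonneg (sub_nonneg.2 (fCoeff_zero_le_one hf)) hk'.le
    rcases Nat.eq_zero_or_pos (Module.finrank (ZMod 2) (Submodule.span (ZMod 2) (fSupp f)))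
      with hr | hr
    · rw [hr, Nat.cast_zero]
      exact mul_nonneg h0 hlog
    obtain ⟨g, hg, hgs, hgmean, hgr⟩ := exists_hyperplaneRestrict hk hf hsparse hr
    have hmean : (1 - fCoeff g 0) * k + 2 ≤ (1 - fCoeff f 0) * k := by
      have h := mul_le_mul_of_nonneg_right hgmean hk'.le
      rw [add_mul, div_mul_cancel₀ _ hk'.ne'] at h
      linarith
    push_cast at hN
    have := ih g hg hgs (by linarith)
    have := mul_le_mul_of_nonneg_right hmean hlog
    linarith

end Walsh

/-- **Improved Chang's lemma for sparse functions.**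
If `f : 𝔽₂ⁿ → {−1,1}` is `k`-Fourier-sparse with `f̂(0ⁿ) = 1 − 2α` and Fourier
dimension `r`, then `r ≤ 2·α·k·log₂ k`. -/
theorem improved_chang {n k : ℕ} (hn : 1 ≤ n) (hk : 2 ≤ k) (α : ℝ) (r : ℕ)
    (f : (Fin n → ZMod 2) → ℝ) (hf : ∀ x, f x = 1 ∨ f x = -1)
    (hsparse : (fSupp f).ncard ≤ k)
    (hα : fCoeff f 0 = 1 - 2 * α)
    (hr : Module.finrank (ZMod 2) (Submodule.span (ZMod 2) (fSupp f)) = r) :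
    (r : ℝ) ≤ 2 * α * k * Real.logb 2 k := by
  have hk' : (0 : ℝ) < k := by positivity
  obtain ⟨N, hN⟩ := exists_nat_gt ((1 - fCoeff f 0) * k / 2)
  have h := finrank_span_fSupp_le hk N f hf hsparse (by linarith)
  rw [hr, hα] at h
  linarith
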